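/- Let d ≥ 1, r > 0, let ‖·‖ be an arbitrary norm on ℝ^d, and let X be an ℝ^d-valued random vector whose law is absolutely continuous with respect to Lebesgue measure and which satisfies H(⌊X⌋) = ∞. Then for every D > 0 the rate-distortion function is infinite: every probability measure π on ℝ^d × ℝ^d whose first marginal is the law of X and which satisfies ∫ ‖x−x̂‖^r dπ(x,x̂) ≤ D has infinite mutual information, i.e., the Kullback–Leibler divergence of π with respect to the product of its marginals equals +∞. -/

import Mathlib

open MeasureTheory ProbabilityTheory Real Filter Topology
open scoped ENNReal

/-- Componentwise integer part of a vector in ℝ^d. -/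
noncomputable def intFloor (d : ℕ) (x : Fin d → ℝ) : Fin d → ℤ := fun i => ⌊x i⌋

/-- Discrete (Shannon) entropy, in nats, of the random element `V` under `P`,
valued in `[0,∞]`. -/
noncomputable def discEnt {Ω α : Type*} [MeasurableSpace Ω] (P : Measure Ω) (V : Ω → α) : ℝ≥0∞ :=
  ∑' a : α, ENNReal.ofReal (Real.negMulLog (P (V ⁻¹' {a})).toReal)

/-- Differential entropy of a measure on ℝ^d (w.r.t. Lebesgue measure),
as a Bochner integral of `-f log f` where `f` is the Radon–Nikodym density. -/
noncomputable def diffEnt {d : ℕ} (μ : Measure (Fin d → ℝ)) : ℝ :=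
  -∫ x, ((μ.rnDeriv volume x).toReal) * Real.log ((μ.rnDeriv volume x).toReal)

open Classical in
/-- Kullback–Leibler divergence of `μ` w.r.t. `ν`, valued in `[0,∞]`. -/
noncomputable def klDiv {α : Type*} [MeasurableSpace α] (μ ν : Measure α) : ℝ≥0∞ :=
  if μ ≪ ν ∧ Integrable (llr μ ν) μ then ENNReal.ofReal (∫ x, llr μ ν x ∂μ) else ⊤

lemma discEnt_eq_lintegral {α ι : Type*} [MeasurableSpace α] [MeasurableSpace ι]
    [Countable ι] [MeasurableSingletonClass ι] (μ : Measure α) [IsFiniteMeasure μ]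
    {V : α → ι} (hV : Measurable V) :
    discEnt μ V = ∫⁻ x, ENNReal.ofReal (-Real.log (μ.real (V ⁻¹' {V x}))) ∂μ := by
  rw [← lintegral_map (f := fun i => ENNReal.ofReal (-Real.log (μ.real (V ⁻¹' {i}))))
    (measurable_of_countable _) hV, lintegral_countable']
  refine tsum_congr fun i => ?_
  rw [Measure.map_apply hV (measurableSet_singleton i), Real.negMulLog, neg_mul, ← mul_neg,
    ENNReal.ofReal_mul ENNReal.toReal_nonneg, ENNReal.ofReal_toReal (measure_ne_top _ _), mul_comm]
  rfl

/-- A countably valued function of the first coordinate has finite entropy as soon as the mutual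
information of the coupling is finite and the function is encoded, given the second coordinate,
by a positive summable weight of finite mean logarithmic loss. -/
lemma discEnt_ne_top_of_klDiv_ne_top {α β ι : Type*} [MeasurableSpace α] [MeasurableSpace β]
    [MeasurableSpace ι] [Countable ι] [MeasurableSingletonClass ι]
    (γ : Measure (α × β)) [IsProbabilityMeasure γ] {V : α → ι} (hV : Measurable V)
    (g : ι → β → ℝ) (hg : ∀ i, Measurable (g i)) (hg0 : ∀ i y, 0 < g i y)
    {C : ℝ≥0∞} (hC : C ≠ ⊤) (hgC : ∀ y, ∑' i, ENNReal.ofReal (g i y) ≤ C)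
    (hlog : ∫⁻ p, ENNReal.ofReal (-Real.log (g (V p.1) p.2)) ∂γ ≠ ⊤)
    (hkl : klDiv γ ((γ.map Prod.fst).prod (γ.map Prod.snd)) ≠ ⊤) :
    discEnt (γ.map Prod.fst) V ≠ ⊤ := by
  have : IsProbabilityMeasure (γ.map Prod.fst) :=
    Measure.isProbabilityMeasure_map measurable_fst.aemeasurable
  have : IsProbabilityMeasure (γ.map Prod.snd) :=
    Measure.isProbabilityMeasure_map measurable_snd.aemeasurable
  set μ := γ.map Prod.fst with hμ
  set μ' := γ.map Prod.snd
  set ρ := μ.prod μ' with hρ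
  obtain ⟨hac, hint⟩ : γ ≪ ρ ∧ Integrable (llr γ ρ) γ := by
    by_contra h
    exact hkl (if_neg h)
  have hgm : Measurable fun p : α × β => g (V p.1) p.2 := by
    have : Measurable fun q : ι × β => g q.1 q.2 := measurable_from_prod_countable_right hg
    exact this.comp (by fun_prop : Measurable fun p : α × β => (V p.1, p.2))
  have hpm : Measurable fun x => μ.real (V ⁻¹' {V x}) :=
    (measurable_of_countable fun i => μ.real (V ⁻¹' {i})).comp hV
  have hfm : Measurable fun p => (γ.rnDeriv ρ p).toReal :=
    (Measure.measurable_rnDeriv γ ρ).ennreal_toReal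
  have hEnt : discEnt μ V = ∫⁻ p, ENNReal.ofReal (-Real.log (μ.real (V ⁻¹' {V p.1}))) ∂γ := by
    rw [discEnt_eq_lintegral μ hV]
    conv_lhs => rw [hμ]
    rw [lintegral_map _ measurable_fst]
    exact (Real.measurable_log.comp hpm).neg.ennreal_ofReal
  have hbound : ∀ᵐ p ∂γ, ENNReal.ofReal (-Real.log (μ.real (V ⁻¹' {V p.1}))) ≤
      ENNReal.ofReal (llr γ ρ p) + ENNReal.ofReal (-Real.log (g (V p.1) p.2)) +
        ENNReal.ofReal (g (V p.1) p.2 / ((γ.rnDeriv ρ p).toReal * μ.real (V ⁻¹' {V p.1}))) := by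
    filter_upwards [Measure.rnDeriv_pos hac, hac.ae_le (Measure.rnDeriv_lt_top γ ρ)] with p h0 h1
    have hf : 0 < (γ.rnDeriv ρ p).toReal := ENNReal.toReal_pos h0.ne' h1.ne
    rcases (measureReal_nonneg (μ := μ) (s := V ⁻¹' {V p.1})).eq_or_lt with hp | hp
    · simp [← hp]
    · refine le_trans (ENNReal.ofReal_le_ofReal ?_)
        (ENNReal.ofReal_add_le.trans (add_le_add_left ENNReal.ofReal_add_le _))
      have hgp := hg0 (V p.1) p.2
      have := Real.log_le_self (x := g (V p.1) p.2 /
        ((γ.rnDeriv ρ p).toReal * μ.real (V ⁻¹' {V p.1}))) (by positivity)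
      nth_rw 1 [Real.log_div (by positivity) (by positivity)] at this
      rw [Real.log_mul (by positivity) (by positivity)] at this
      rw [llr]
      linarith
  have hlast : ∫⁻ p, ENNReal.ofReal
      (g (V p.1) p.2 / ((γ.rnDeriv ρ p).toReal * μ.real (V ⁻¹' {V p.1}))) ∂γ ≤ C := by
    calc _ = ∫⁻ p, γ.rnDeriv ρ p * ENNReal.ofReal
          (g (V p.1) p.2 / ((γ.rnDeriv ρ p).toReal * μ.real (V ⁻¹' {V p.1}))) ∂ρ := by
          rw [lintegral_rnDeriv_mul hac]
          exact (hgm.div (hfm.mul (hpm.comp measurable_fst))).ennreal_ofReal.aemeasurable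
      _ ≤ ∫⁻ p, ENNReal.ofReal (g (V p.1) p.2 / μ.real (V ⁻¹' {V p.1})) ∂ρ := by
          refine lintegral_mono_ae ?_
          filter_upwards [Measure.rnDeriv_lt_top γ ρ] with p h1
          have hgp := hg0 (V p.1) p.2
          nth_rw 1 [← ENNReal.ofReal_toReal h1.ne]
          rw [← ENNReal.ofReal_mul ENNReal.toReal_nonneg]
          refine ENNReal.ofReal_le_ofReal ?_
          rcases (ENNReal.toReal_nonneg (a := γ.rnDeriv ρ p)).eq_or_lt with hf | hf
          · rw [← hf, zero_mul]; positivity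
          · rw [mul_div_assoc', mul_div_mul_left _ _ hf.ne']
      _ = ∫⁻ y, ∫⁻ x, ENNReal.ofReal (g (V x) y / μ.real (V ⁻¹' {V x})) ∂μ ∂μ' := by
          rw [hρ, lintegral_prod_symm]
          exact (hgm.div (hpm.comp measurable_fst)).ennreal_ofReal.aemeasurable
      _ ≤ ∫⁻ _, C ∂μ' := by
          refine lintegral_mono fun y => le_trans ?_ (hgC y)
          rw [← lintegral_map (f := fun i => ENNReal.ofReal (g i y / μ.real (V ⁻¹' {i})))
            (measurable_of_countable _) hV, lintegral_countable']
          refine ENNReal.tsum_le_tsum fun i => ?_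
          rw [Measure.map_apply hV (measurableSet_singleton i), ← ofReal_measureReal,
            ← ENNReal.ofReal_mul (div_nonneg (hg0 i y).le measureReal_nonneg)]
          refine ENNReal.ofReal_le_ofReal ?_
          rcases eq_or_ne (μ.real (V ⁻¹' {i})) 0 with hp | hp
          · simpa [hp] using (hg0 i y).le
          · exact (div_mul_cancel₀ _ hp).le
      _ = C := by simp
  rw [hEnt]
  refine ne_top_of_le_ne_top ?_ (lintegral_mono_ae hbound)
  rw [lintegral_add_left, lintegral_add_left]
  · exact ENNReal.add_ne_top.2 ⟨ENNReal.add_ne_top.2 ⟨hint.lintegral_lt_top.ne, hlog⟩,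
      ne_top_of_le_ne_top hC hlast⟩
  · exact (measurable_llr γ ρ).ennreal_ofReal
  · exact (measurable_llr γ ρ).ennreal_ofReal.add (Real.measurable_log.comp hgm).neg.ennreal_ofReal

lemma measurable_intFloor (d : ℕ) : Measurable (intFloor d) :=
  measurable_pi_lambda _ fun i => Int.measurable_floor.comp (measurable_pi_apply i)

lemma volume_intFloor_preimage (d : ℕ) (k : Fin d → ℤ) :
    volume (intFloor d ⁻¹' {k}) = 1 := by
  have : intFloor d ⁻¹' {k} = Set.univ.pi fun i => Set.Ico (k i : ℝ) (k i + 1) := by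
    ext x
    simp [intFloor, funext_iff, Int.floor_eq_iff]
  rw [this, volume_pi_pi]
  simp

lemma norm_le_norm_intFloor_add_one (d : ℕ) (x : Fin d → ℝ) : ‖x‖ ≤ ‖intFloor d x‖ + 1 := by
  refine (pi_norm_le_iff_of_nonneg (by positivity)).2 fun i => ?_
  have h := norm_le_pi_norm (intFloor d x) i
  rw [Int.norm_eq_abs] at h
  rw [Real.norm_eq_abs]
  have h1 := Int.floor_le (x i)
  have h2 := Int.lt_floor_add_one (x i)
  have h3 := abs_le.1 h
  simp only [intFloor] at h3
  exact abs_le.2 ⟨by linarith, by linarith⟩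

lemma norm_intFloor_sub_intFloor_le (d : ℕ) (x y : Fin d → ℝ) :
    ‖intFloor d x - intFloor d y‖ ≤ ‖x - y‖ + 1 := by
  refine (pi_norm_le_iff_of_nonneg (by positivity)).2 fun i => ?_
  have h := norm_le_pi_norm (x - y) i
  rw [Real.norm_eq_abs] at h
  rw [Int.norm_eq_abs]
  have h1 := Int.floor_le (x i)
  have h2 := Int.lt_floor_add_one (x i)
  have h4 := Int.floor_le (y i)
  have h5 := Int.lt_floor_add_one (y i)
  have h3 := abs_le.1 h
  simp only [Pi.sub_apply] at h3
  simp only [intFloor, Pi.sub_apply]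
  push_cast
  exact abs_le.2 ⟨by linarith, by linarith⟩

lemma tsum_two_add_norm_rpow_ne_top (d : ℕ) {s : ℝ} (hs : (d : ℝ) < s) :
    ∑' k : Fin d → ℤ, ENNReal.ofReal ((2 + ‖k‖) ^ (-s)) ≠ ⊤ := by
  have h : ∑' k : Fin d → ℤ, ENNReal.ofReal ((2 + ‖k‖) ^ (-s)) =
      ∫⁻ x : Fin d → ℝ, ENNReal.ofReal ((2 + ‖intFloor d x‖) ^ (-s)) := by
    rw [← lintegral_map (f := fun k : Fin d → ℤ => ENNReal.ofReal ((2 + ‖k‖) ^ (-s)))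
      (measurable_of_countable _) (measurable_intFloor d), lintegral_countable']
    refine tsum_congr fun k => ?_
    rw [Measure.map_apply (measurable_intFloor d) (measurableSet_singleton k),
      volume_intFloor_preimage, mul_one]
  rw [h]
  refine ne_top_of_le_ne_top
    (finite_integral_one_add_norm (E := Fin d → ℝ) (μ := volume) (r := s) (by simpa)).ne
    (lintegral_mono fun x => ENNReal.ofReal_le_ofReal ?_)
  refine Real.rpow_le_rpow_of_nonpos (by positivity) ?_ ?_
  · linarith [norm_le_norm_intFloor_add_one d x]
  · linarith [(Nat.cast_nonneg d : (0 : ℝ) ≤ d)]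

lemma Seminorm.exists_norm_le_mul {E : Type*} [NormedAddCommGroup E] [NormedSpace ℝ E]
    [FiniteDimensional ℝ E] (ν : Seminorm ℝ E) (hν : ∀ x, ν x = 0 → x = 0)
    (hc : Continuous fun x => ν x) : ∃ K : ℝ, 0 < K ∧ ∀ x, ‖x‖ ≤ K * ν x := by
  have : ProperSpace E := FiniteDimensional.proper_real E
  rcases subsingleton_or_nontrivial E with hE | hE
  · exact ⟨1, one_pos, fun x => by simp [Subsingleton.elim x 0]⟩
  obtain ⟨x₀, hx₀, hmin⟩ := (isCompact_sphere (0 : E) 1).exists_isMinOn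
    (NormedSpace.sphere_nonempty.2 zero_le_one) hc.continuousOn
  have hx₀' : ‖x₀‖ = 1 := by simpa using hx₀
  have hpos : 0 < ν x₀ := (apply_nonneg ν x₀).lt_of_ne fun h => by
    simp [hν x₀ h.symm] at hx₀'
  refine ⟨(ν x₀)⁻¹, by positivity, fun x => ?_⟩
  rcases eq_or_ne x 0 with rfl | hx
  · simp
  have hxn : 0 < ‖x‖ := norm_pos_iff.2 hx
  have h := hmin (show ‖x‖⁻¹ • x ∈ Metric.sphere (0 : E) 1 by simp [norm_smul, hxn.ne'])
  simp only [Set.mem_ofPred_eq, map_smul_eq_mul, norm_inv, norm_norm] at h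
  rw [inv_mul_eq_div, le_div_iff₀ hpos]
  rwa [inv_mul_eq_div, le_div_iff₀ hxn, mul_comm] at h

lemma Real.exists_log_add_mul_le {a K r : ℝ} (ha : 1 ≤ a) (hK : 0 ≤ K) (hr : 0 < r) :
    ∃ A B : ℝ, 0 ≤ B ∧ ∀ t, 0 ≤ t → Real.log (a + K * t) ≤ A + B * t ^ r := by
  refine ⟨(2 * a) ^ r / r, (2 * K) ^ r / r, by positivity, fun t ht => ?_⟩
  have hKt : 0 ≤ K * t := by positivity
  refine (Real.log_le_rpow_div (by positivity) hr).trans ?_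
  rw [div_mul_eq_mul_div, ← add_div, ← Real.mul_rpow (by positivity) ht]
  refine div_le_div_of_nonneg_right ?_ hr.le
  rcases le_total a (K * t) with h | h
  · have h1 : (a + K * t) ^ r ≤ (2 * K * t) ^ r :=
      Real.rpow_le_rpow (by positivity) (by linarith) hr.le
    have h2 : 0 ≤ (2 * a) ^ r := by positivity
    linarith
  · have h1 : (a + K * t) ^ r ≤ (2 * a) ^ r :=
      Real.rpow_le_rpow (by positivity) (by linarith) hr.le
    have h2 : 0 ≤ (2 * K * t) ^ r := by positivity
    linarith

/-- **Infinite rate-distortion function** (Theorem 2, converse part).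
If `H(⌊X⌋) = ∞`, then every coupling with first marginal the law of `X` and
expected `r`-th power distortion at most `D` has infinite mutual information. -/
theorem rateDistortion_infinite_of_floorEntropy_infinite
    {Ω : Type*} [MeasurableSpace Ω] (P : Measure Ω) [IsProbabilityMeasure P]
    (d : ℕ) (hd : 1 ≤ d) (r : ℝ) (hr : 0 < r)
    (ν : Seminorm ℝ (Fin d → ℝ)) (hνdef : ∀ x, ν x = 0 → x = 0)
    (hνcont : Continuous fun x => ν x)
    (X : Ω → (Fin d → ℝ)) (hX : Measurable X)
    (hac : Measure.map X P ≪ volume)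
    (hH : discEnt P (fun ω => intFloor d (X ω)) = ⊤) :
    ∀ D : ℝ, 0 < D →
    ∀ μπ : Measure ((Fin d → ℝ) × (Fin d → ℝ)), IsProbabilityMeasure μπ →
      μπ.map Prod.fst = Measure.map X P →
      (∫⁻ p, ENNReal.ofReal (ν (p.1 - p.2) ^ r) ∂μπ ≤ ENNReal.ofReal D) →
      klDiv μπ ((μπ.map Prod.fst).prod (μπ.map Prod.snd)) = ⊤ := by
  intro D _ γ _ hfst hdist
  by_contra hkl
  have hent : discEnt (γ.map Prod.fst) (intFloor d) = ⊤ := by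
    rw [hfst, ← hH]
    refine tsum_congr fun k => ?_
    rw [Measure.map_apply hX (measurable_intFloor d (measurableSet_singleton k))]
    rfl
  obtain ⟨K, hK, hνK⟩ := ν.exists_norm_le_mul hνdef hνcont
  obtain ⟨A, B, hB, hAB⟩ :=
    Real.exists_log_add_mul_le (a := 3) (by norm_num) hK.le hr
  have hs : (d : ℝ) < d + 1 := by linarith
  refine discEnt_ne_top_of_klDiv_ne_top γ (measurable_intFloor d)
    (fun k y => (2 + ‖k - intFloor d y‖) ^ (-((d : ℝ) + 1))) (fun k => ?_)
    (fun k y => by positivity) (tsum_two_add_norm_rpow_ne_top d hs)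
    (fun y => ?_) ?_ hkl hent
  · exact (measurable_of_countable fun j : Fin d → ℤ => (2 + ‖k - j‖) ^ (-((d : ℝ) + 1))).comp
      (measurable_intFloor d)
  · exact ((Equiv.subRight (intFloor d y)).tsum_eq
      fun k => ENNReal.ofReal ((2 + ‖k‖) ^ (-((d : ℝ) + 1)))).le
  · have hle : ∀ p : (Fin d → ℝ) × (Fin d → ℝ),
        ENNReal.ofReal (-Real.log ((2 + ‖intFloor d p.1 - intFloor d p.2‖) ^ (-((d : ℝ) + 1)))) ≤
          ENNReal.ofReal ((d + 1) * A) +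
            ENNReal.ofReal ((d + 1) * B) * ENNReal.ofReal (ν (p.1 - p.2) ^ r) := by
      intro p
      rw [← ENNReal.ofReal_mul (by positivity)]
      refine (ENNReal.ofReal_le_ofReal ?_).trans ENNReal.ofReal_add_le
      rw [Real.log_rpow (by positivity), neg_mul, neg_neg, mul_assoc, ← mul_add]
      refine mul_le_mul_of_nonneg_left (le_trans (Real.log_le_log (by positivity) ?_)
        (hAB _ (apply_nonneg ν (p.1 - p.2)))) (by positivity)
      linarith [norm_intFloor_sub_intFloor_le d p.1 p.2, hνK (p.1 - p.2)]
    refine ne_top_of_le_ne_top ?_ (lintegral_mono hle)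
    rw [lintegral_add_left measurable_const, lintegral_const_mul' _ _ ENNReal.ofReal_ne_top]
    refine ENNReal.add_ne_top.2 ⟨by simp, ENNReal.mul_ne_top ENNReal.ofReal_ne_top ?_⟩
    exact ne_top_of_le_ne_top ENNReal.ofReal_ne_top hdist
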